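/- Let N ≥ 2. The coagulation–fragmentation Markov chain on Δ_{N−1} with kernel K is irreducible with respect to the uniform measure: for every Borel set A ⊆ Δ_{N−1} whose uniform measure U(A) is positive and every starting point x ∈ Δ_{N−1}, the probability under P_x that the chain hits A within the first N−1 steps is strictly positive, i.e. P_x(τ_A ≤ N−1) > 0. -/

import Mathlib

open MeasureTheory Filter
open scoped ENNReal NNReal Topology

/-- The coagulation–fragmentation map `T_{i,j,u}` on `ℝ^N`: the `i`-th coordinate of the
output is `u (x_i + x_j)`, the `j`-th coordinate is `(1-u)(x_i + x_j)`, and all other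
coordinates are unchanged. -/
noncomputable def cfT (N : ℕ) (i j : Fin N) (u : ℝ) (x : Fin N → ℝ) : Fin N → ℝ :=
  Function.update (Function.update x i (u * (x i + x j))) j ((1 - u) * (x i + x j))

/-- The coagulation–fragmentation kernel on the simplex `Δ_{N-1}`, viewed as a
measure-valued map: `K(x, A) = (1/(N(N-1))) ∑_{(i,j) : i ≠ j} Leb{u ∈ [0,1] : T_{i,j,u}(x) ∈ A}`. -/
noncomputable def cfK (N : ℕ) (x : Fin N → ℝ) : Measure (Fin N → ℝ) :=
  ((N : ℝ≥0∞) * ((N : ℝ≥0∞) - 1))⁻¹ •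
    ∑ p ∈ Finset.univ.filter (fun p : Fin N × Fin N => p.1 ≠ p.2),
      (volume.restrict (Set.Icc (0 : ℝ) 1)).map (fun u => cfT N p.1 p.2 u x)

/-- The uniform distribution on the simplex `Δ_{N-1}`: the `(N-1)`-dimensional Hausdorff
measure restricted to `Δ_{N-1}` and normalized to be a probability measure. -/
noncomputable def uniformSimplex (N : ℕ) : Measure (Fin N → ℝ) :=
  (μH[(N : ℝ) - 1] (stdSimplex ℝ (Fin N)))⁻¹ •
    μH[(N : ℝ) - 1].restrict (stdSimplex ℝ (Fin N))

/-- Iterated action of a (measure-valued) Markov transition `κ` on an initial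
distribution: `evolve κ k μ = μ κ^k` is the time-`k` marginal of the chain with initial
distribution `μ` and transition kernel `κ`. -/
noncomputable def evolve {α : Type*} [MeasurableSpace α] (κ : α → Measure α) :
    ℕ → Measure α → Measure α
  | 0, μ => μ
  | k + 1, μ => (evolve κ k μ).bind κ

/-- `hitProb κ B m x` is the probability `P_x(τ_B ≤ m)` that the Markov chain with
transition kernel `κ` started at `x` hits the set `B` within the first `m` steps, where
`τ_B = inf{k ≥ 1 : X_k ∈ B}` is the first hitting time of `B`. It is defined through the
one-step (Markov) recursion
`P_x(τ_B ≤ m+1) = ∫ (1_B(y) + 1_{Bᶜ}(y) P_y(τ_B ≤ m)) κ(x, dy)`, `P_x(τ_B ≤ 0) = 0`. -/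
noncomputable def hitProb {α : Type*} [MeasurableSpace α] (κ : α → MeasureTheory.Measure α)
    (B : Set α) : ℕ → α → ℝ≥0∞
  | 0, _ => 0
  | m + 1, x =>
      ∫⁻ y, (B.indicator (fun _ => 1) y + Bᶜ.indicator (hitProb κ B m) y) ∂(κ x)

theorem measurable_cfT (N : ℕ) (i j : Fin N) :
    Measurable fun p : (Fin N → ℝ) × ℝ => cfT N i j p.2 p.1 := by
  refine measurable_pi_iff.2 fun k => ?_
  simp only [cfT, Function.update_apply]
  split_ifs <;> fun_prop

theorem measurable_cfK (N : ℕ) : Measurable (cfK N) := by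
  refine Measure.measurable_of_measurable_coe _ fun s hs => ?_
  simp only [cfK, Measure.smul_apply, Measure.finsetSum_apply, smul_eq_mul]
  refine Measurable.const_mul (Finset.measurable_fun_sum _ fun p _ => ?_) _
  have h (x : Fin N → ℝ) :
      (volume.restrict (Set.Icc (0 : ℝ) 1)).map (fun u => cfT N p.1 p.2 u x) s =
        volume.restrict (Set.Icc (0 : ℝ) 1)
          (Prod.mk x ⁻¹' ((fun q : (Fin N → ℝ) × ℝ => cfT N p.1 p.2 q.2 q.1) ⁻¹' s)) :=
    Measure.map_apply ((measurable_cfT N p.1 p.2).comp measurable_prodMk_left) hs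
  simp only [h]
  exact measurable_measure_prodMk_left (measurable_cfT N p.1 p.2 hs)

theorem measurable_hitProb {α : Type*} [MeasurableSpace α] {κ : α → Measure α}
    (hκ : Measurable κ) {B : Set α} (hB : MeasurableSet B) (m : ℕ) :
    Measurable (hitProb κ B m) := by
  induction m with
  | zero => exact measurable_const
  | succ m ih =>
    have hf : Measurable fun y => B.indicator (fun _ => (1 : ℝ≥0∞)) y +
        Bᶜ.indicator (hitProb κ B m) y :=
      (measurable_const.indicator hB).add (ih.indicator hB.compl)
    exact (Measure.measurable_lintegral hf).comp hκ

/-- If the chain does not hit `B` within `m + 1` steps, then almost surely after one step it is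
outside `B` and does not hit `B` within `m` further steps. -/
theorem ae_of_hitProb_succ_eq_zero {α : Type*} [MeasurableSpace α] {κ : α → Measure α}
    (hκ : Measurable κ) {B : Set α} (hB : MeasurableSet B) {m : ℕ} {x : α}
    (h : hitProb κ B (m + 1) x = 0) : ∀ᵐ y ∂κ x, y ∉ B ∧ hitProb κ B m y = 0 := by
  have hf : Measurable fun y => B.indicator (fun _ => (1 : ℝ≥0∞)) y +
      Bᶜ.indicator (hitProb κ B m) y :=
    (measurable_const.indicator hB).add ((measurable_hitProb hκ hB m).indicator hB.compl)
  rw [hitProb, lintegral_eq_zero_iff hf] at h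
  filter_upwards [h] with y hy
  by_cases hyB : y ∈ B <;> simp_all

theorem ae_cfT_of_ae_cfK {N : ℕ} {x : Fin N → ℝ} {P : (Fin N → ℝ) → Prop}
    (h : ∀ᵐ y ∂cfK N x, P y) {i j : Fin N} (hij : i ≠ j) :
    ∀ᵐ u, u ∈ Set.Icc (0 : ℝ) 1 → P (cfT N i j u x) := by
  have hc : ((N : ℝ≥0∞) * ((N : ℝ≥0∞) - 1))⁻¹ ≠ 0 :=
    ENNReal.inv_ne_zero.2 (ENNReal.mul_ne_top (by simp) (by simp))
  rw [cfK, Measure.ae_ennreal_smul_measure_iff hc] at h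
  have hle : (volume.restrict (Set.Icc (0 : ℝ) 1)).map (fun u => cfT N i j u x) ≤
      ∑ p ∈ Finset.univ.filter (fun p : Fin N × Fin N => p.1 ≠ p.2),
        (volume.restrict (Set.Icc (0 : ℝ) 1)).map (fun u => cfT N p.1 p.2 u x) :=
    Finset.single_le_sum (f := fun p : Fin N × Fin N =>
      (volume.restrict (Set.Icc (0 : ℝ) 1)).map (fun u => cfT N p.1 p.2 u x))
      (fun _ _ => Measure.zero_le _) (a := (i, j)) (by simpa using hij)
  have h' := ae_of_ae_map ((measurable_cfT N i j).comp measurable_prodMk_left).aemeasurable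
    (h.filter_mono (ae_mono hle))
  exact (ae_restrict_iff' measurableSet_Icc).1 h'

/-- The result of the transfer between coordinates `i` and `j` that leaves mass `t` at `i`. -/
noncomputable def transfer {N : ℕ} (i j : Fin N) (x : Fin N → ℝ) (t : ℝ) : Fin N → ℝ :=
  Function.update (Function.update x i t) j (x i + x j - t)

theorem continuous_transfer {N : ℕ} (i j : Fin N) :
    Continuous fun p : (Fin N → ℝ) × ℝ => transfer i j p.1 p.2 := by
  unfold transfer
  fun_prop

theorem ae_transfer {N : ℕ} {x : Fin N → ℝ} {P : (Fin N → ℝ) → Prop}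
    (h : ∀ᵐ y ∂cfK N x, P y) {i j : Fin N} (hij : i ≠ j) :
    ∀ᵐ t : ℝ, 0 < t → t ≤ x i + x j → P (transfer i j x t) := by
  rcases le_or_gt (x i + x j) 0 with hs | hs
  · exact Eventually.of_forall fun t h0 h1 => absurd (h0.trans_le h1) hs.not_gt
  have hq : Measure.QuasiMeasurePreserving (fun t : ℝ => (x i + x j)⁻¹ * t) volume volume :=
    ⟨by fun_prop, by
      rw [Real.map_volume_mul_left (inv_ne_zero hs.ne')]
      exact Measure.smul_absolutelyContinuous⟩
  filter_upwards [hq.ae (ae_cfT_of_ae_cfK h hij)] with t ht h0 h1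
  convert ht ⟨by positivity, ?_⟩ using 1
  · unfold transfer cfT
    congr 2 <;> field_simp
  · rw [inv_mul_eq_div]
    exact (div_le_one hs).2 h1

/-- Successive transfers along consecutive pairs of `idx`, the `i`-th of which leaves mass `z i`
at `idx i`. -/
noncomputable def chainTransfer {N : ℕ} :
    (m : ℕ) → (Fin (m + 1) → Fin N) → (Fin N → ℝ) → (Fin m → ℝ) → Fin N → ℝ
  | 0, _, x, _ => x
  | m + 1, idx, x, z =>
    chainTransfer m (Fin.tail idx) (transfer (idx 0) (idx 1) x (z 0)) (Fin.tail z)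

/-- Every mass prescribed in `chainTransfer` is positive and available at its step. -/
def Feasible {N : ℕ} :
    (m : ℕ) → (Fin (m + 1) → Fin N) → (Fin N → ℝ) → (Fin m → ℝ) → Prop
  | 0, _, _, _ => True
  | m + 1, idx, x, z => 0 < z 0 ∧ z 0 ≤ x (idx 0) + x (idx 1) ∧
    Feasible m (Fin.tail idx) (transfer (idx 0) (idx 1) x (z 0)) (Fin.tail z)

theorem continuous_chainTransfer {N : ℕ} (m : ℕ) (idx : Fin (m + 1) → Fin N) :
    Continuous fun p : (Fin N → ℝ) × (Fin m → ℝ) => chainTransfer m idx p.1 p.2 := by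
  induction m with
  | zero => exact continuous_fst
  | succ m ih =>
    refine (ih (Fin.tail idx)).comp (Continuous.prodMk
      ((continuous_transfer (idx 0) (idx 1)).comp
        (f := fun p : (Fin N → ℝ) × (Fin (m + 1) → ℝ) => (p.1, p.2 0)) (by fun_prop)) ?_)
    exact continuous_pi fun i => by fun_prop

theorem measurableSet_feasible {N : ℕ} (m : ℕ) (idx : Fin (m + 1) → Fin N) :
    MeasurableSet {p : (Fin N → ℝ) × (Fin m → ℝ) | Feasible m idx p.1 p.2} := by
  induction m with
  | zero => simp [Feasible]
  | succ m ih =>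
    have hz : Measurable fun p : (Fin N → ℝ) × (Fin (m + 1) → ℝ) => p.2 0 := by fun_prop
    have hs : Measurable fun p : (Fin N → ℝ) × (Fin (m + 1) → ℝ) =>
      p.1 (idx 0) + p.1 (idx 1) := by fun_prop
    refine (measurableSet_lt measurable_const hz).inter ((measurableSet_le hz hs).inter ?_)
    refine (Continuous.measurable (Continuous.prodMk
      ((continuous_transfer (idx 0) (idx 1)).comp
        (f := fun p : (Fin N → ℝ) × (Fin (m + 1) → ℝ) => (p.1, p.2 0)) (by fun_prop)) ?_))
      (ih (Fin.tail idx))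
    exact continuous_pi fun i => by fun_prop

theorem ae_chainTransfer_notMem {N : ℕ} {A : Set (Fin N → ℝ)} (hA : MeasurableSet A) (m : ℕ)
    (idx : Fin (m + 1) → Fin N) (hidx : Function.Injective idx) (x : Fin N → ℝ)
    (hx : hitProb (cfK N) A m x = 0) (hx0 : m = 0 → x ∉ A) :
    ∀ᵐ z : Fin m → ℝ, Feasible m idx x z → chainTransfer m idx x z ∉ A := by
  induction m generalizing x with
  | zero => exact Eventually.of_forall fun _ _ => hx0 rfl
  | succ m ih =>
    have hstep := ae_transfer (ae_of_hitProb_succ_eq_zero (measurable_cfK N) hA hx)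
      (hidx.ne (Fin.zero_ne_one : (0 : Fin (m + 2)) ≠ 1))
    have hpair : ∀ᵐ t : ℝ, ∀ᵐ z : Fin m → ℝ, Feasible (m + 1) idx x (Fin.cons t z) →
        chainTransfer (m + 1) idx x (Fin.cons t z) ∉ A := by
      filter_upwards [hstep] with t ht
      by_cases hc : 0 < t ∧ t ≤ x (idx 0) + x (idx 1)
      · obtain ⟨hA', h0⟩ := ht hc.1 hc.2
        filter_upwards [ih (Fin.tail idx) (hidx.comp (Fin.succ_injective _)) _ h0 fun _ => hA']
          with z hz hf
        exact hz hf.2.2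
      · exact Eventually.of_forall fun z hf => absurd ⟨hf.1, hf.2.1⟩ hc
    have hmp := (volume_preserving_piFinSuccAbove (fun _ : Fin (m + 1) => ℝ) 0)
    have hmeas : MeasurableSet {z : Fin (m + 1) → ℝ | Feasible (m + 1) idx x z →
        chainTransfer (m + 1) idx x z ∉ A} := by
      refine MeasurableSet.imp ?_ (MeasurableSet.compl ?_)
      · exact measurable_prodMk_left (measurableSet_feasible (m + 1) idx)
      · exact ((continuous_chainTransfer (m + 1) idx).measurable.comp measurable_prodMk_left) hA
    have hsymm := (hmp.symm _).quasiMeasurePreserving.measurable hmeas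
    have hprod := (Measure.ae_prod_iff_ae_ae (μ := volume) (ν := volume) hsymm).2 (by
      simpa [MeasurableEquiv.piFinSuccAbove, Fin.insertNthEquiv] using hpair)
    filter_upwards [hmp.quasiMeasurePreserving.ae hprod] with z hz
    simpa only [Set.mem_preimage, Set.mem_ofPred_eq, MeasurableEquiv.symm_apply_apply] using hz

theorem feasible_and_chainTransfer_eq {N : ℕ} (y : Fin N → ℝ) (m : ℕ)
    (idx : Fin (m + 1) → Fin N) (hidx : Function.Injective idx) (x : Fin N → ℝ)
    (hx : ∀ i, 0 ≤ x (idx i)) (hy : ∀ i : Fin m, 0 < y (idx i.castSucc))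
    (hoff : ∀ k, k ∉ Set.range idx → x k = y k)
    (hmono : Monotone fun i => y (idx i) - x (idx i))
    (hsum : ∑ i, (y (idx i) - x (idx i)) = 0) :
    Feasible m idx x (fun i => y (idx i.castSucc)) ∧
      chainTransfer m idx x (fun i => y (idx i.castSucc)) = y := by
  induction m generalizing x with
  | zero =>
    refine ⟨trivial, funext fun k => ?_⟩
    by_cases hk : k ∈ Set.range idx
    · obtain ⟨i, rfl⟩ := hk
      rw [Fin.sum_univ_one] at hsum
      rw [Fin.fin_one_eq_zero i]
      exact (sub_eq_zero.1 hsum).symm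
    · exact hoff k hk
  | succ m ih =>
    have h01 : idx 0 ≠ idx 1 := hidx.ne Fin.zero_ne_one
    have hle : y (idx 0) ≤ x (idx 0) := by
      by_contra! hlt
      have : 0 < ∑ i, (y (idx i) - x (idx i)) :=
        Finset.sum_pos (fun i _ => (sub_pos.2 hlt).trans_le (hmono (Fin.zero_le i)))
          Finset.univ_nonempty
      exact this.ne' hsum
    set x' := transfer (idx 0) (idx 1) x (y (idx 0)) with hx'
    have hx'0 : x' (idx 0) = y (idx 0) := by simp [hx', transfer, h01]
    have hx'1 : x' (idx 1) = x (idx 0) + x (idx 1) - y (idx 0) := by simp [hx', transfer]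
    have hx'k (k) (hk0 : k ≠ idx 0) (hk1 : k ≠ idx 1) : x' k = x k := by
      simp [hx', transfer, hk0, hk1]
    have hx'ss (i : Fin m) : x' (idx i.succ.succ) = x (idx i.succ.succ) :=
      hx'k _ (hidx.ne (Fin.succ_ne_zero _)) (hidx.ne (by
        rw [← Fin.succ_zero_eq_one]
        exact (Fin.succ_injective _).ne (Fin.succ_ne_zero _)))
    have hmono' : Monotone fun i => y (Fin.tail idx i) - x' (Fin.tail idx i) := by
      intro i j hij
      have hm := hmono (Fin.succ_le_succ_iff.2 hij)
      simp only [Fin.tail] at hm ⊢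
      cases i using Fin.cases with
      | zero =>
        cases j using Fin.cases with
        | zero => rfl
        | succ j =>
          rw [hx'ss]
          simp only [Fin.succ_zero_eq_one] at hm ⊢
          rw [hx'1]
          linarith
      | succ i =>
        cases j using Fin.cases with
        | zero => simp at hij
        | succ j => rwa [hx'ss, hx'ss]
    have hsum' : ∑ i, (y (Fin.tail idx i) - x' (Fin.tail idx i)) = 0 := by
      rw [Fin.sum_univ_succ, Fin.sum_univ_succ] at hsum
      rw [Fin.sum_univ_succ]
      simp only [Fin.tail, hx'ss, Fin.succ_zero_eq_one, hx'1] at hsum ⊢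
      linarith
    have hnonneg (i) : 0 ≤ x' (Fin.tail idx i) := by
      cases i using Fin.cases with
      | zero =>
        simp only [Fin.tail, Fin.succ_zero_eq_one, hx'1]
        linarith [hx 1]
      | succ i =>
        simp only [Fin.tail, hx'ss]
        exact hx _
    have hoff' (k) (hk : k ∉ Set.range (Fin.tail idx)) : x' k = y k := by
      by_cases hk0 : k = idx 0
      · rw [hk0, hx'0]
      have hk' (i) : k ≠ idx i := by
        cases i using Fin.cases with
        | zero => exact hk0
        | succ i => exact fun h => hk ⟨i, h.symm⟩
      rw [hx'k k hk0 (hk' 1)]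
      exact hoff k fun ⟨i, hi⟩ => hk' i hi.symm
    obtain ⟨hf, he⟩ := ih (Fin.tail idx) (hidx.comp (Fin.succ_injective _)) x' hnonneg
      (fun i => hy i.succ) hoff' hmono' hsum'
    refine ⟨⟨hy 0, ?_, hf⟩, he⟩
    simp only [Fin.castSucc_zero]
    linarith [hx 1]

/-- The parametrization of the hyperplane `∑ i, y i = 1` by all coordinates but `σ (Fin.last n)`. -/
noncomputable def hyperplaneParam {n : ℕ} (σ : Equiv.Perm (Fin (n + 1))) (z : Fin n → ℝ) :
    Fin (n + 1) → ℝ :=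
  fun k => (Fin.snoc z (1 - ∑ i, z i) : Fin (n + 1) → ℝ) (σ.symm k)

theorem hyperplaneParam_eq {n : ℕ} (σ : Equiv.Perm (Fin (n + 1))) {y : Fin (n + 1) → ℝ}
    (hy : ∑ i, y i = 1) : hyperplaneParam σ (fun i => y (σ i.castSucc)) = y := by
  rw [← Equiv.sum_comp σ, Fin.sum_univ_castSucc] at hy
  have hsnoc (i) : (Fin.snoc (fun i => y (σ i.castSucc)) (1 - ∑ i : Fin n, y (σ i.castSucc)) :
      Fin (n + 1) → ℝ) i = y (σ i) := by
    cases i using Fin.lastCases with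
    | last => rw [Fin.snoc_last]; linarith
    | cast i => rw [Fin.snoc_castSucc]
  funext k
  simp [hyperplaneParam, hsnoc]

theorem lipschitzWith_hyperplaneParam {n : ℕ} (σ : Equiv.Perm (Fin (n + 1))) :
    LipschitzWith (n + 1) (hyperplaneParam σ) := by
  refine LipschitzWith.of_dist_le_mul fun z w => ?_
  have hd : 0 ≤ dist z w := dist_nonneg
  have hn : (0 : ℝ) ≤ n * dist z w := by positivity
  push_cast
  refine (dist_pi_le_iff (by positivity)).2 fun k => ?_
  unfold hyperplaneParam
  cases σ.symm k using Fin.lastCases with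
  | last =>
    simp only [Fin.snoc_last, dist_sub_left]
    refine (dist_sum_sum_le _ _ _).trans ?_
    refine (Finset.sum_le_card_nsmul _ _ _ fun i _ => dist_le_pi_dist z w i).trans ?_
    simp only [Finset.card_univ, Fintype.card_fin, nsmul_eq_mul]
    linarith
  | cast i =>
    simp only [Fin.snoc_castSucc]
    linarith [dist_le_pi_dist z w i]

theorem hausdorffMeasure_image_hyperplaneParam {n : ℕ} (σ : Equiv.Perm (Fin (n + 1)))
    {s : Set (Fin n → ℝ)} (hs : volume s = 0) : μH[(n : ℝ)] (hyperplaneParam σ '' s) = 0 := by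
  have h := (lipschitzWith_hyperplaneParam σ).hausdorffMeasure_image_le (Nat.cast_nonneg n) s
  have hv : μH[(n : ℝ)] s = 0 := by
    rw [← hs, ← hausdorffMeasure_pi_real, Fintype.card_fin]
  rw [hv, mul_zero] at h
  exact le_antisymm h zero_le

/-- The coagulation–fragmentation chain on `Δ_{N-1}` is irreducible with respect to the
uniform measure: for every Borel set `A ⊆ Δ_{N-1}` of positive uniform measure and every
starting point `x ∈ Δ_{N-1}`, the chain hits `A` within the first `N-1` steps with
strictly positive probability: `P_x(τ_A ≤ N-1) > 0`. -/
theorem cfK_irreducible (N : ℕ) (hN : 2 ≤ N) (A : Set (Fin N → ℝ))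
    (hA : MeasurableSet A) (hApos : 0 < uniformSimplex N A)
    (x : Fin N → ℝ) (hx : x ∈ stdSimplex ℝ (Fin N)) :
    0 < hitProb (cfK N) A (N - 1) x := by
  obtain ⟨n, rfl⟩ : ∃ n, N = n + 1 := ⟨N - 1, by omega⟩
  rw [Nat.add_sub_cancel]
  by_contra hzero
  replace hzero : hitProb (cfK (n + 1)) A n x = 0 := by simpa using hzero
  refine hApos.ne' ?_
  have hdim : ((n + 1 : ℕ) : ℝ) - 1 = n := by simp
  rw [uniformSimplex, hdim, Measure.smul_apply, Measure.restrict_apply hA, smul_eq_mul]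
  refine mul_eq_zero_of_right _ ?_
  let bad (σ : Equiv.Perm (Fin (n + 1))) : Set (Fin n → ℝ) :=
    {z | ¬ ((Feasible n σ x z → chainTransfer n σ x z ∉ A) ∧ ∀ i, z i ≠ 0)}
  have hbad (σ) : volume (bad σ) = 0 := by
    refine ae_iff.1 ((ae_chainTransfer_notMem hA n σ σ.injective x hzero (by omega)).and ?_)
    exact ae_all_iff.2 fun i => Measure.ae_eval_ne (fun _ => volume) i 0
  refine measure_mono_null (t := ⋃ σ, hyperplaneParam σ '' bad σ) ?_
    (measure_iUnion_null fun σ => hausdorffMeasure_image_hyperplaneParam σ (hbad σ))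
  rintro y ⟨hyA, hy⟩
  let σ := Tuple.sort fun i => y i - x i
  refine Set.mem_iUnion.2 ⟨σ, _, fun ⟨hne, hz⟩ => ?_, hyperplaneParam_eq σ hy.2⟩
  obtain ⟨hf, he⟩ := feasible_and_chainTransfer_eq y n σ σ.injective x (fun i => hx.1 _)
    (fun i => (hy.1 _).lt_of_ne' (hz i)) (fun k hk => absurd (σ.surjective k) hk)
    (Tuple.monotone_sort fun i => y i - x i)
    ((Equiv.sum_comp σ fun i => y i - x i).trans (by
      rw [Finset.sum_sub_distrib, hx.2, hy.2, sub_self]))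
  exact hne hf (Set.mem_of_eq_of_mem he hyA)
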